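/- Set c₀ := (1/16 − 1/(log 2 + 16))^{−1/2}, a positive real number. For every ρ > 0 there exists a C^∞ function h : ℝ → [0,1] such that h(s) = 1 for all s ≤ ρ/2, h(s) = 0 for all s ≥ ρ, and for every s ∈ ℝ: ρ·|h′(s)| ≤ c₀, ρ²·|h″(s)| ≤ 2c₀·e^{14}, and ρ³·|h‴(s)| ≤ (4e^{−4} + (9/2)e^{−3} + 8e^{−2})·c₀·e^{16}. -/

import Mathlib

/-- The explicit constant c₀ := (1/16 − 1/(log 2 + 16))^{−1/2}. -/
noncomputable def bumpConst : ℝ := ((1 : ℝ) / 16 - 1 / (Real.log 2 + 16)) ^ (-(1 : ℝ) / 2)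

open Real in
lemma cut_u2 (u : ℝ) (hu : 0 ≤ u) : u ^ 2 * exp (-u) ≤ 1 := by
  have h1 := Real.quadratic_le_exp_of_nonneg (x := u / 2) (by positivity)
  have h2 : u ≤ exp (u / 2) := by nlinarith [sq_nonneg (u - 2)]
  have h3 : exp u = exp (u / 2) * exp (u / 2) := by rw [← exp_add]; ring_nf
  have h4 : u ^ 2 ≤ exp u := by rw [h3]; nlinarith
  rw [exp_neg, ← div_eq_mul_inv]
  exact (div_le_one (exp_pos _)).2 h4

lemma cut_un (n : ℕ) (u : ℝ) (hu : 0 ≤ u) : u ^ n * Real.exp (-u) ≤ n.factorial := by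
  have h := Real.pow_div_factorial_le_exp u hu n
  have hf : (0 : ℝ) < n.factorial := by exact_mod_cast n.factorial_pos
  rw [div_le_iff₀ hf] at h
  rw [Real.exp_neg, ← div_eq_mul_inv, div_le_iff₀ (Real.exp_pos _)]
  linarith

noncomputable def cutF1 (x : ℝ) : ℝ := x⁻¹ ^ 2 * expNegInvGlue x
noncomputable def cutF2 (x : ℝ) : ℝ := (x⁻¹ ^ 4 - 2 * x⁻¹ ^ 3) * expNegInvGlue x
noncomputable def cutF3 (x : ℝ) : ℝ :=
  (x⁻¹ ^ 6 - 6 * x⁻¹ ^ 5 + 6 * x⁻¹ ^ 4) * expNegInvGlue x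

open Polynomial in
lemma cut_d0 (x : ℝ) : HasDerivAt expNegInvGlue (cutF1 x) x := by
  have := expNegInvGlue.hasDerivAt_polynomial_eval_inv_mul (1 : ℝ[X]) x
  simpa [cutF1] using this

open Polynomial in
lemma cut_d1 (x : ℝ) : HasDerivAt cutF1 (cutF2 x) x := by
  have := expNegInvGlue.hasDerivAt_polynomial_eval_inv_mul (X ^ 2 : ℝ[X]) x
  convert this using 1
  · funext y; simp [cutF1]
  · simp only [cutF2]
    congr 1
    simp
    ring

open Polynomial in
lemma cut_d2 (x : ℝ) : HasDerivAt cutF2 (cutF3 x) x := by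
  have := expNegInvGlue.hasDerivAt_polynomial_eval_inv_mul (X ^ 4 - C 2 * X ^ 3 : ℝ[X]) x
  convert this using 1
  · funext y; simp [cutF2]
  · simp only [cutF3]
    congr 1
    simp
    ring

lemma cut_cases (x : ℝ) : expNegInvGlue x = 0 ∨
    (0 ≤ x⁻¹ ∧ expNegInvGlue x = Real.exp (-x⁻¹)) := by
  rcases le_or_gt x 0 with h | h
  · left; exact expNegInvGlue.zero_of_nonpos h
  · right; exact ⟨by positivity, by simp [expNegInvGlue, not_le.2 h]⟩

lemma cut_b1 (x : ℝ) : 0 ≤ cutF1 x ∧ cutF1 x ≤ 1 := by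
  unfold cutF1
  rcases cut_cases x with h | ⟨h, e⟩
  · simp [h]
  · rw [e]; exact ⟨by positivity, cut_u2 _ h⟩

lemma cut_b2 (x : ℝ) : |cutF2 x| ≤ 36 := by
  unfold cutF2
  rcases cut_cases x with h | ⟨h, e⟩
  · simp [h]
  · rw [e]
    have h4 := cut_un 4 _ h
    have h3 := cut_un 3 _ h
    have p4 : 0 ≤ x⁻¹ ^ 4 * Real.exp (-x⁻¹) := by positivity
    have p3 : 0 ≤ x⁻¹ ^ 3 * Real.exp (-x⁻¹) := by positivity
    norm_num only [Nat.factorial] at h4 h3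
    rw [abs_le]; constructor <;> linarith

lemma cut_b3 (x : ℝ) : |cutF3 x| ≤ 1584 := by
  unfold cutF3
  rcases cut_cases x with h | ⟨h, e⟩
  · simp [h]
  · rw [e]
    have h4 := cut_un 4 _ h
    have h5 := cut_un 5 _ h
    have h6 := cut_un 6 _ h
    have p4 : 0 ≤ x⁻¹ ^ 4 * Real.exp (-x⁻¹) := by positivity
    have p5 : 0 ≤ x⁻¹ ^ 5 * Real.exp (-x⁻¹) := by positivity
    have p6 : 0 ≤ x⁻¹ ^ 6 * Real.exp (-x⁻¹) := by positivity
    norm_num only [Nat.factorial] at h4 h5 h6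
    rw [abs_le]; constructor <;> linarith

noncomputable def cutD (x : ℝ) : ℝ := expNegInvGlue x + expNegInvGlue (1 - x)
noncomputable def cutD1 (x : ℝ) : ℝ := cutF1 x - cutF1 (1 - x)
noncomputable def cutD2 (x : ℝ) : ℝ := cutF2 x + cutF2 (1 - x)
noncomputable def cutD3 (x : ℝ) : ℝ := cutF3 x - cutF3 (1 - x)
noncomputable def cutS1 (x : ℝ) : ℝ :=
  (cutF1 x - Real.smoothTransition x * cutD1 x) / cutD x
noncomputable def cutS2 (x : ℝ) : ℝ :=
  (cutF2 x - 2 * cutS1 x * cutD1 x - Real.smoothTransition x * cutD2 x) / cutD x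
noncomputable def cutS3 (x : ℝ) : ℝ :=
  (cutF3 x - 3 * cutS2 x * cutD1 x - 3 * cutS1 x * cutD2 x
    - Real.smoothTransition x * cutD3 x) / cutD x

lemma cut_exp2 : Real.exp 2 ≤ 8 := by
  have h := Real.exp_one_lt_d9
  have : Real.exp 2 = Real.exp 1 * Real.exp 1 := by rw [← Real.exp_add]; norm_num
  rw [this]; nlinarith [Real.exp_pos 1]

lemma cut_half (y : ℝ) (hy : 1 / 2 ≤ y) : 1 / 8 ≤ expNegInvGlue y := by
  have h0 : 0 < y := by linarith
  have e : expNegInvGlue y = Real.exp (-y⁻¹) := by simp [expNegInvGlue, not_le.2 h0]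
  have h1 : y⁻¹ ≤ 2 := by
    rw [inv_le_comm₀ h0 (by norm_num)]; linarith
  have h2 : Real.exp (-2) ≤ Real.exp (-y⁻¹) := Real.exp_le_exp.2 (by linarith)
  have h3 : (1 : ℝ) / 8 ≤ Real.exp (-2) := by
    rw [Real.exp_neg, one_div]
    exact inv_anti₀ (Real.exp_pos _) cut_exp2
  rw [e]; linarith

lemma cut_D_ge (x : ℝ) : 1 / 8 ≤ cutD x := by
  unfold cutD
  have h1 := expNegInvGlue.nonneg x
  have h2 := expNegInvGlue.nonneg (1 - x)
  rcases le_total (1 / 2) x with h | h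
  · linarith [cut_half x h]
  · linarith [cut_half (1 - x) (by linarith)]

lemma cut_refl {f : ℝ → ℝ} {f' x : ℝ} (h : HasDerivAt f f' (1 - x)) :
    HasDerivAt (fun y => f (1 - y)) (-f') x := by
  have h2 : HasDerivAt (fun y : ℝ => 1 - y) (-1) x := by
    simpa using (hasDerivAt_id x).const_sub 1
  have := HasDerivAt.comp x h h2
  simpa [Function.comp_def] using this

lemma cut_dD (x : ℝ) : HasDerivAt cutD (cutD1 x) x := by
  have := (cut_d0 x).add (cut_refl (cut_d0 (1 - x)))
  exact this

lemma cut_dD1 (x : ℝ) : HasDerivAt cutD1 (cutD2 x) x := by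
  have := (cut_d1 x).sub (cut_refl (cut_d1 (1 - x)))
  rw [sub_neg_eq_add] at this
  exact this

lemma cut_dD2 (x : ℝ) : HasDerivAt cutD2 (cutD3 x) x := by
  have := (cut_d2 x).add (cut_refl (cut_d2 (1 - x)))
  exact this

lemma cut_S_eq (x : ℝ) : Real.smoothTransition x = expNegInvGlue x / cutD x := rfl

lemma cut_dS (x : ℝ) : HasDerivAt Real.smoothTransition (cutS1 x) x := by
  have hD : cutD x ≠ 0 := by linarith [cut_D_ge x] |> fun h : 0 < cutD x => h.ne'
  have := (cut_d0 x).div (cut_dD x) hD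
  refine this.congr_deriv ?_
  unfold cutS1
  rw [cut_S_eq]
  field_simp

lemma cut_dS1 (x : ℝ) : HasDerivAt cutS1 (cutS2 x) x := by
  have hD : cutD x ≠ 0 := by linarith [cut_D_ge x] |> fun h : 0 < cutD x => h.ne'
  have := ((cut_d1 x).sub ((cut_dS x).mul (cut_dD1 x))).div (cut_dD x) hD
  refine this.congr_deriv ?_
  have e : cutF1 x - Real.smoothTransition x * cutD1 x = cutS1 x * cutD x := by
    unfold cutS1; field_simp
  simp only [Pi.sub_apply, Pi.mul_apply]
  rw [e]
  unfold cutS2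
  field_simp
  ring

lemma cut_dS2 (x : ℝ) : HasDerivAt cutS2 (cutS3 x) x := by
  have hD : cutD x ≠ 0 := by linarith [cut_D_ge x] |> fun h : 0 < cutD x => h.ne'
  have := (((cut_d2 x).sub (((cut_dS1 x).const_mul 2).mul (cut_dD1 x))).sub
    ((cut_dS x).mul (cut_dD2 x))).div (cut_dD x) hD
  refine this.congr_deriv ?_
  have e : cutF2 x - 2 * cutS1 x * cutD1 x - Real.smoothTransition x * cutD2 x
      = cutS2 x * cutD x := by
    unfold cutS2; field_simp
  simp only [Pi.sub_apply, Pi.mul_apply]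
  rw [e]
  unfold cutS3
  field_simp
  ring

lemma cut_div (x a M : ℝ) (h : |a| ≤ M) : |a / cutD x| ≤ 8 * M := by
  have hD := cut_D_ge x
  have hp : 0 < cutD x := by linarith
  have hM : 0 ≤ M := (abs_nonneg a).trans h
  rw [abs_div, abs_of_pos hp, div_le_iff₀ hp]
  nlinarith

lemma cut_D1_le (x : ℝ) : |cutD1 x| ≤ 1 := by
  have h1 := cut_b1 x
  have h2 := cut_b1 (1 - x)
  unfold cutD1
  rw [abs_le]; constructor <;> linarith

lemma cut_D2_le (x : ℝ) : |cutD2 x| ≤ 72 :=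
  (abs_add_le _ _).trans (by linarith [cut_b2 x, cut_b2 (1 - x)])

lemma cut_D3_le (x : ℝ) : |cutD3 x| ≤ 3168 :=
  (abs_sub _ _).trans (by linarith [cut_b3 x, cut_b3 (1 - x)])

lemma cut_S_le (x : ℝ) : |Real.smoothTransition x| ≤ 1 := by
  rw [abs_of_nonneg (Real.smoothTransition.nonneg x)]
  exact Real.smoothTransition.le_one x

lemma cut_mul {a b A B : ℝ} (ha : |a| ≤ A) (hb : |b| ≤ B) : |a * b| ≤ A * B := by
  rw [abs_mul]
  exact mul_le_mul ha hb (abs_nonneg _) ((abs_nonneg _).trans ha)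

lemma cut_S1_le (x : ℝ) : |cutS1 x| ≤ 8 := by
  have h1 := cut_b1 x
  have h2 := cut_b1 (1 - x)
  have s0 := Real.smoothTransition.nonneg x
  have s1 := Real.smoothTransition.le_one x
  have : |cutF1 x - Real.smoothTransition x * cutD1 x| ≤ 1 := by
    unfold cutD1
    rw [abs_le]
    constructor <;> nlinarith
  exact (cut_div x _ _ this).trans (by norm_num)

lemma cut_S2_le (x : ℝ) : |cutS2 x| ≤ 1120 := by
  have a := cut_b2 x
  have b := cut_mul (cut_S1_le x) (cut_D1_le x)
  have c := cut_mul (cut_S_le x) (cut_D2_le x)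
  have : |cutF2 x - 2 * cutS1 x * cutD1 x - Real.smoothTransition x * cutD2 x| ≤ 140 := by
    rw [mul_assoc]
    rw [abs_le] at *
    constructor <;> linarith
  exact (cut_div x _ _ this).trans (by norm_num)

lemma cut_S3_le (x : ℝ) : |cutS3 x| ≤ 105600 := by
  have a := cut_b3 x
  have b := cut_mul (cut_S2_le x) (cut_D1_le x)
  have c := cut_mul (cut_S1_le x) (cut_D2_le x)
  have d := cut_mul (cut_S_le x) (cut_D3_le x)
  have : |cutF3 x - 3 * cutS2 x * cutD1 x - 3 * cutS1 x * cutD2 x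
    - Real.smoothTransition x * cutD3 x| ≤ 13200 := by
    rw [mul_assoc, mul_assoc]
    rw [abs_le] at *
    constructor <;> linarith
  exact (cut_div x _ _ this).trans (by norm_num)

lemma cut_const : 16 ≤ bumpConst := by
  unfold bumpConst
  have l0 : 0 < Real.log 2 := Real.log_pos (by norm_num)
  have l1 : Real.log 2 ≤ 1 := by linarith [Real.log_two_lt_d9]
  set L := Real.log 2
  have hp : 0 < (1 : ℝ) / 16 - 1 / (L + 16) := by
    have : (1 : ℝ) / 16 - 1 / (L + 16) = L / (16 * (L + 16)) := by field_simp; ring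
    rw [this]; positivity
  have hle : (1 : ℝ) / 16 - 1 / (L + 16) ≤ 1 / 256 := by
    have : (1 : ℝ) / 16 - 1 / (L + 16) = L / (16 * (L + 16)) := by field_simp; ring
    rw [this, div_le_iff₀ (by positivity)]; linarith
  have h := Real.rpow_le_rpow_of_nonpos hp hle (z := -(1 : ℝ) / 2) (by norm_num)
  refine le_trans (le_of_eq ?_) h
  have : (1 / 256 : ℝ) = 16 ^ (-2 : ℝ) := by
    rw [Real.rpow_neg (by norm_num)]; norm_num
  rw [this, ← Real.rpow_mul (by norm_num)]; norm_num

lemma cut_exp14 : 16384 ≤ Real.exp 14 := by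
  have h : (2 : ℝ) ≤ Real.exp 1 := by linarith [Real.exp_one_gt_d9]
  have e : Real.exp 14 = Real.exp 1 ^ 14 := by rw [← Real.exp_nat_mul]; norm_num
  rw [e]
  calc (16384 : ℝ) = 2 ^ 14 := by norm_num
    _ ≤ _ := by gcongr

lemma cut_scale {f : ℝ → ℝ} {f' : ℝ → ℝ} (hf : ∀ x, HasDerivAt f (f' x) x) (c k : ℝ) :
    deriv (fun s => c * f (2 - k * s)) = fun s => (c * -k) * f' (2 - k * s) := by
  funext s
  have h2 : HasDerivAt (fun y : ℝ => 2 - k * y) (-k) s := by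
    simpa using ((hasDerivAt_id s).const_mul k).const_sub 2
  have := (HasDerivAt.comp s (hf (2 - k * s)) h2).const_mul c
  have h3 := this.deriv
  simp only [Function.comp_def] at h3
  rw [h3]; ring

/-- existence of a one-dimensional cut-off function with explicit
derivative bounds in terms of c₀ = (1/16 − 1/(log 2 + 16))^{−1/2}. -/
theorem one_dimensional_cutoff (ρ : ℝ) (hρ : 0 < ρ) :
    0 < bumpConst ∧
    ∃ h : ℝ → ℝ, ContDiff ℝ (⊤ : ℕ∞) h ∧
      (∀ s : ℝ, 0 ≤ h s ∧ h s ≤ 1) ∧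
      (∀ s : ℝ, s ≤ ρ / 2 → h s = 1) ∧
      (∀ s : ℝ, ρ ≤ s → h s = 0) ∧
      (∀ s : ℝ, ρ * |deriv h s| ≤ bumpConst) ∧
      (∀ s : ℝ, ρ ^ 2 * |deriv (deriv h) s| ≤ 2 * bumpConst * Real.exp 14) ∧
      (∀ s : ℝ, ρ ^ 3 * |deriv (deriv (deriv h)) s| ≤
        (4 * Real.exp (-4) + (9 / 2) * Real.exp (-3) + 8 * Real.exp (-2)) *
          bumpConst * Real.exp 16) := by
  have hc := cut_const
  have he := cut_exp14
  refine ⟨by linarith, fun s => 1 * Real.smoothTransition (2 - (2 / ρ) * s), ?_, ?_, ?_, ?_, ?_⟩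
  · have : ContDiff ℝ (⊤ : ℕ∞) Real.smoothTransition := Real.smoothTransition.contDiff
    exact contDiff_const.mul (this.comp (by fun_prop))
  · intro s
    simp only [one_mul]
    exact ⟨Real.smoothTransition.nonneg _, Real.smoothTransition.le_one _⟩
  · intro s hs
    simp only [one_mul]
    apply Real.smoothTransition.one_of_one_le
    have : 2 / ρ * s ≤ 2 / ρ * (ρ / 2) := by gcongr
    have e : 2 / ρ * (ρ / 2) = 1 := by field_simp
    linarith
  · intro s hs
    simp only [one_mul]
    apply Real.smoothTransition.zero_of_nonpos
    have : 2 / ρ * ρ ≤ 2 / ρ * s := by gcongr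
    have e : 2 / ρ * ρ = 2 := by field_simp
    linarith
  · rw [cut_scale cut_dS, cut_scale cut_dS1, cut_scale cut_dS2]
    refine ⟨fun s => ?_, fun s => ?_, fun s => ?_⟩
    · have h := cut_S1_le (2 - 2 / ρ * s)
      have e : ρ * |1 * -(2 / ρ) * cutS1 (2 - 2 / ρ * s)| = 2 * |cutS1 (2 - 2 / ρ * s)| := by
        rw [abs_mul, one_mul, abs_neg, abs_of_pos (by positivity)]; field_simp
      rw [e]; linarith
    · have h := cut_S2_le (2 - 2 / ρ * s)
      have e : ρ ^ 2 * |1 * -(2 / ρ) * -(2 / ρ) * cutS2 (2 - 2 / ρ * s)|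
          = 4 * |cutS2 (2 - 2 / ρ * s)| := by
        rw [abs_mul, abs_mul, one_mul, abs_neg, abs_of_pos (by positivity)]; field_simp; ring
      rw [e]; nlinarith
    · have h := cut_S3_le (2 - 2 / ρ * s)
      have e : ρ ^ 3 * |1 * -(2 / ρ) * -(2 / ρ) * -(2 / ρ) * cutS3 (2 - 2 / ρ * s)|
          = 8 * |cutS3 (2 - 2 / ρ * s)| := by
        rw [abs_mul, abs_mul, abs_mul, one_mul, abs_neg, abs_of_pos (by positivity)]
        field_simp; ring
      rw [e]
      have e2 : Real.exp 14 = Real.exp (-2) * Real.exp 16 := by rw [← Real.exp_add]; norm_num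
      have p3 := Real.exp_pos (-3)
      have p4 := Real.exp_pos (-4)
      have p16 := Real.exp_pos 16
      calc 8 * |cutS3 (2 - 2 / ρ * s)| ≤ 8 * 16 * 16384 := by linarith
        _ ≤ 8 * bumpConst * Real.exp 14 := by gcongr
        _ = (8 * Real.exp (-2)) * bumpConst * Real.exp 16 := by rw [e2]; ring
        _ ≤ _ := by
          gcongr
          linarith
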